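/- For every approval-based committee voting instance, there exists a randomized committee (λ_1, W_1), …, (λ_s, W_s) such that every integral committee W_j in its support satisfies EJR+, and the fractional committee p that it implements satisfies both GFS and Strong UFS. -/

import Mathlib

open Finset

namespace BWCV

variable {n m : ℕ}

/-- Utility of voter `i` for a fractional committee `p`. -/
def utility (A : Fin n → Finset (Fin m)) (p : Fin m → ℝ) (i : Fin n) : ℝ :=
  ∑ c ∈ A i, p c

/-- `p` is a fractional committee of size `k`. -/
def IsFractionalCommittee (k : ℕ) (p : Fin m → ℝ) : Prop :=
  (∀ c, 0 ≤ p c ∧ p c ≤ 1) ∧ ∑ c, p c = (k : ℝ)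

/-- Group Fair Share. -/
def GFS (k : ℕ) (A : Fin n → Finset (Fin m)) (p : Fin m → ℝ) : Prop :=
  ∀ S : Finset (Fin n),
    (1 / (n : ℝ)) * ∑ i ∈ S, ((min k (A i).card : ℕ) : ℝ) ≤ ∑ c ∈ S.biUnion A, p c

/-- Unanimous Fair Share. -/
def UFS (k : ℕ) (A : Fin n → Finset (Fin m)) (p : Fin m → ℝ) : Prop :=
  ∀ S : Finset (Fin n), (∀ i ∈ S, ∀ j ∈ S, A i = A j) →
    ∀ i ∈ S, ((S.card : ℝ) / n) * ((min k (A i).card : ℕ) : ℝ) ≤ utility A p i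

/-- Strong Unanimous Fair Share. -/
def StrongUFS (k : ℕ) (A : Fin n → Finset (Fin m)) (p : Fin m → ℝ) : Prop :=
  ∀ S : Finset (Fin n), (∀ i ∈ S, ∀ j ∈ S, A i = A j) →
    ∀ i ∈ S, min ((S.card : ℝ) * k / n) ((A i).card : ℝ) ≤ utility A p i

/-- Individual Fair Share. -/
def IFS (k : ℕ) (A : Fin n → Finset (Fin m)) (p : Fin m → ℝ) : Prop :=
  ∀ i, (1 / (n : ℝ)) * ((min k (A i).card : ℕ) : ℝ) ≤ utility A p i

/-- Strong Individual Fair Share. -/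
def StrongIFS (k : ℕ) (A : Fin n → Finset (Fin m)) (p : Fin m → ℝ) : Prop :=
  ∀ i, min ((k : ℝ) / n) ((A i).card : ℝ) ≤ utility A p i

/-- An `ℓ`-cohesive group of voters: `|N'| ≥ ℓ·n/k` and the voters in `N'`
commonly approve at least `ℓ` candidates. -/
def Cohesive (k : ℕ) (A : Fin n → Finset (Fin m)) (ℓ : ℕ) (N' : Finset (Fin n)) : Prop :=
  ((ℓ : ℝ) * n / k ≤ (N'.card : ℝ)) ∧ ℓ ≤ (N'.inf A).card

/-- Justified Representation. -/
def JR (k : ℕ) (A : Fin n → Finset (Fin m)) (W : Finset (Fin m)) : Prop :=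
  ∀ N' : Finset (Fin n), Cohesive k A 1 N' → ∃ i ∈ N', (A i ∩ W).Nonempty

/-- Proportional Justified Representation. -/
def PJR (k : ℕ) (A : Fin n → Finset (Fin m)) (W : Finset (Fin m)) : Prop :=
  ∀ ℓ : ℕ, 0 < ℓ → ∀ N' : Finset (Fin n), Cohesive k A ℓ N' →
    ℓ ≤ ((N'.biUnion A) ∩ W).card

/-- Extended Justified Representation. -/
def EJR (k : ℕ) (A : Fin n → Finset (Fin m)) (W : Finset (Fin m)) : Prop :=
  ∀ ℓ : ℕ, 0 < ℓ → ∀ N' : Finset (Fin n), Cohesive k A ℓ N' →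
    ∃ i ∈ N', ℓ ≤ (A i ∩ W).card

/-- EJR+. -/
def EJRplus (k : ℕ) (A : Fin n → Finset (Fin m)) (W : Finset (Fin m)) : Prop :=
  ¬ ∃ (c : Fin m) (N' : Finset (Fin n)) (ℓ : ℕ), c ∉ W ∧ 0 < ℓ ∧
      ((ℓ : ℝ) * n / k ≤ (N'.card : ℝ)) ∧ (∀ i ∈ N', c ∈ A i) ∧
      (∀ i ∈ N', (A i ∩ W).card < ℓ)

/-- A weakly `(β, T)`-cohesive group of voters. -/
def WeaklyCohesive (k : ℕ) (A : Fin n → Finset (Fin m)) (β : ℕ) (T : Finset (Fin m))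
    (N' : Finset (Fin n)) : Prop :=
  ((T.card : ℝ) * n / k ≤ (N'.card : ℝ)) ∧ ∀ i ∈ N', β ≤ (A i ∩ T).card

/-- Fully Justified Representation. -/
def FJR (k : ℕ) (A : Fin n → Finset (Fin m)) (W : Finset (Fin m)) : Prop :=
  ∀ β : ℕ, 0 < β → ∀ T : Finset (Fin m), ∀ N' : Finset (Fin n),
    WeaklyCohesive k A β T N' → ∃ i ∈ N', β ≤ (A i ∩ W).card

/-- The randomized committee `(lam, W)` implements the fractional committee `p`. -/
def Implements {s : ℕ} (lam : Fin s → ℝ) (W : Fin s → Finset (Fin m)) (p : Fin m → ℝ) : Prop :=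
  ∀ c, p c = ∑ j, lam j * (if c ∈ W j then 1 else 0)

/-- What is left of the initial budget `k / n` of voter `i` after the payments `y`. -/
noncomputable def remainingBudget (k : ℕ) (y : Fin n → Fin m → ℝ) (i : Fin n) : ℝ :=
  (k : ℝ) / n - ∑ c, y i c

/-- The invariant of the Method of Equal Shares, for the set `W` of elected candidates and the
payments `y`. -/
structure IsEqualSharesState (k : ℕ) (A : Fin n → Finset (Fin m)) (W : Finset (Fin m))
    (y : Fin n → Fin m → ℝ) : Prop where
  nonneg : ∀ i c, 0 ≤ y i c
  eq_zero_of_notMem : ∀ i c, c ∉ W → y i c = 0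
  eq_zero_of_not_approved : ∀ i c, c ∉ A i → y i c = 0
  sum_eq_one : ∀ c ∈ W, ∑ i, y i c = 1
  remaining_nonneg : ∀ i, 0 ≤ remainingBudget k y i
  fair : ∀ i, ∀ c ∈ A i ∩ W, 1 / (n : ℝ) ≤ y i c ∨ remainingBudget k y i = 0
  payment_le : ∀ (c : Fin m) (N' : Finset (Fin n)) (l : ℕ), c ∉ W → 0 < l →
    (l : ℝ) * n / k ≤ (N'.card : ℝ) → (∀ i ∈ N', c ∈ A i) → (∀ i ∈ N', (A i ∩ W).card < l) →
    ∀ i ∈ N', ∀ c', y i c' ≤ (k : ℝ) / (n * l)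

/-- In a group witnessing a violation of EJR+, every voter can still pay `k / (n * l)`. -/
lemma IsEqualSharesState.le_remainingBudget {k : ℕ} {A : Fin n → Finset (Fin m)}
    {W : Finset (Fin m)} {y : Fin n → Fin m → ℝ} (h : IsEqualSharesState k A W y) {c : Fin m}
    {N' : Finset (Fin n)} {l : ℕ} (hc : c ∉ W) (hl : 0 < l)
    (hN : (l : ℝ) * n / k ≤ (N'.card : ℝ)) (hA : ∀ i ∈ N', c ∈ A i)
    (hW : ∀ i ∈ N', (A i ∩ W).card < l) {i : Fin n} (hi : i ∈ N') :
    (k : ℝ) / (n * l) ≤ remainingBudget k y i := by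
  have hn : (0 : ℝ) < n := by exact_mod_cast i.pos
  have hl' : (0 : ℝ) < l := by exact_mod_cast hl
  have hsum : ∑ c, y i c = ∑ c ∈ A i ∩ W, y i c := by
    symm
    apply Finset.sum_subset (subset_univ _)
    intro x _ hx
    by_cases h1 : x ∈ A i
    · exact h.eq_zero_of_notMem i x fun h2 => hx (mem_inter.2 ⟨h1, h2⟩)
    · exact h.eq_zero_of_not_approved i x h1
  have hle : ∑ c ∈ A i ∩ W, y i c ≤ (A i ∩ W).card • ((k : ℝ) / (n * l)) :=
    Finset.sum_le_card_nsmul _ _ _ fun x _ => h.payment_le c N' l hc hl hN hA hW i hi x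
  have hcard : ((A i ∩ W).card : ℝ) ≤ l - 1 := by
    have : (A i ∩ W).card + 1 ≤ l := hW i hi
    have : ((A i ∩ W).card : ℝ) + 1 ≤ l := by exact_mod_cast this
    linarith
  have hpos : 0 ≤ (k : ℝ) / (n * l) := by positivity
  have h3 : ((A i ∩ W).card : ℝ) * ((k : ℝ) / (n * l)) ≤ (l - 1) * ((k : ℝ) / (n * l)) := by
    gcongr
  have h4 : (k : ℝ) / n = l * ((k : ℝ) / (n * l)) := by field_simp
  rw [nsmul_eq_mul] at hle
  unfold remainingBudget
  rw [hsum, h4]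
  linarith

/-- A group large enough for `l` candidates can buy one at price `k / (n * l)` per voter. -/
lemma one_le_sum_of_large {k : ℕ} (hk : 0 < k) {N' : Finset (Fin n)} {l : ℕ} (hn : 0 < n)
    (hl : 0 < l) (hN : (l : ℝ) * n / k ≤ (N'.card : ℝ)) {f : Fin n → ℝ}
    (hf : ∀ i ∈ N', (k : ℝ) / (n * l) ≤ f i) : 1 ≤ ∑ i ∈ N', f i := by
  have hn' : (0 : ℝ) < n := by exact_mod_cast hn
  have hl' : (0 : ℝ) < l := by exact_mod_cast hl
  have hk' : (0 : ℝ) < k := by exact_mod_cast hk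
  have h1 : N'.card • ((k : ℝ) / (n * l)) ≤ ∑ i ∈ N', f i := Finset.card_nsmul_le_sum _ _ _ hf
  have h2 : (l : ℝ) * n / k * ((k : ℝ) / (n * l)) ≤ N'.card * ((k : ℝ) / (n * l)) := by gcongr
  have h3 : (l : ℝ) * n / k * ((k : ℝ) / (n * l)) = 1 := by field_simp
  rw [nsmul_eq_mul] at h1
  linarith

/-- If the supporters of some candidate outside `W` can afford it, then there is a least price
per voter at which some candidate outside `W` can be bought. -/
lemma exists_least_price (A : Fin n → Finset (Fin m)) (W : Finset (Fin m)) {b : Fin n → ℝ}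
    (hb : ∀ i, 0 ≤ b i) (h : ∃ c ∉ W, 1 ≤ ∑ i with c ∈ A i, b i) :
    ∃ (r : ℝ) (c₀ : Fin m), 0 ≤ r ∧ c₀ ∉ W ∧ ∑ i with c₀ ∈ A i, min (b i) r = 1 ∧
      ∀ c ∉ W, ∀ r', 0 ≤ r' → 1 ≤ ∑ i with c ∈ A i, min (b i) r' → r ≤ r' := by
  have hcont : ∀ c, Continuous fun r : ℝ => ∑ i with c ∈ A i, min (b i) r := fun c => by
    fun_prop
  set P : Set ℝ := {r | 0 ≤ r ∧ ∃ c ∉ W, ∑ i with c ∈ A i, min (b i) r = 1} with hP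
  have hPeq : P = Set.Ici 0 ∩ ⋃ c ∈ {c : Fin m | c ∉ W},
      {r | ∑ i with c ∈ A i, min (b i) r = 1} := by
    ext r; simp [hP]
  have hclosed : IsClosed P := by
    rw [hPeq]
    exact isClosed_Ici.inter ((Set.toFinite _).isClosed_biUnion fun c _ =>
      isClosed_eq (hcont c) continuous_const)
  have hbdd : BddBelow P := ⟨0, fun r hr => hr.1⟩
  have key : ∀ c ∉ W, ∀ r', 0 ≤ r' → 1 ≤ ∑ i with c ∈ A i, min (b i) r' → ∃ r ∈ P, r ≤ r' := by
    intro c hc r' hr' h1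
    have h0 : ∑ i with c ∈ A i, min (b i) 0 = 0 :=
      Finset.sum_eq_zero fun i _ => min_eq_right (hb i)
    obtain ⟨r, hr, hr1⟩ := intermediate_value_Icc hr' (hcont c).continuousOn
      (show (1 : ℝ) ∈ Set.Icc _ _ from ⟨by simp only [h0]; norm_num, h1⟩)
    exact ⟨r, ⟨hr.1, c, hc, hr1⟩, hr.2⟩
  have hne : P.Nonempty := by
    obtain ⟨c, hc, h1⟩ := h
    have hmin : ∀ i, min (b i) (∑ j, b j) = b i := fun i =>
      min_eq_left (Finset.single_le_sum (fun j _ => hb j) (mem_univ i))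
    obtain ⟨r, hr, -⟩ := key c hc (∑ j, b j) (Finset.sum_nonneg fun j _ => hb j)
      (by simpa only [hmin] using h1)
    exact ⟨r, hr⟩
  obtain ⟨h0, c₀, hc₀, h1⟩ := hclosed.csInf_mem hne hbdd
  refine ⟨sInf P, c₀, h0, hc₀, h1, fun c hc r' hr' h2 => ?_⟩
  obtain ⟨r, hr, hrr⟩ := key c hc r' hr' h2
  exact (csInf_le hbdd hr).trans hrr

/-- One round of the Method of Equal Shares. -/
lemma IsEqualSharesState.exists_insert {k : ℕ} (hn : 0 < n) (hk : 0 < k)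
    {A : Fin n → Finset (Fin m)} {W : Finset (Fin m)} {y : Fin n → Fin m → ℝ}
    (h : IsEqualSharesState k A W y)
    (hc : ∃ c ∉ W, 1 ≤ ∑ i with c ∈ A i, remainingBudget k y i) :
    ∃ c₀ ∉ W, ∃ y', IsEqualSharesState k A (insert c₀ W) y' := by
  obtain ⟨r, c₀, hr, hc₀, hsum, hleast⟩ := exists_least_price A W h.remaining_nonneg hc
  set b := remainingBudget k y with hb
  set q : Fin n → ℝ := fun i => if c₀ ∈ A i then min (b i) r else 0 with hq
  have hq0 : ∀ i, 0 ≤ q i := fun i => by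
    simp only [hq]; split_ifs
    exacts [le_min (h.remaining_nonneg i) hr, le_rfl]
  have hqb : ∀ i, q i ≤ b i := fun i => by
    simp only [hq]; split_ifs
    exacts [min_le_left _ _, h.remaining_nonneg i]
  have hqr : ∀ i, q i ≤ r := fun i => by
    simp only [hq]; split_ifs
    exacts [min_le_right _ _, hr]
  have hqsum : ∑ i, q i = 1 := by rw [← hsum, Finset.sum_filter]
  have hn' : (0 : ℝ) < n := by exact_mod_cast hn
  have hrn : 1 / (n : ℝ) ≤ r := by
    have : ∑ i, q i ≤ ∑ _i : Fin n, r := Finset.sum_le_sum fun i _ => hqr i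
    rw [hqsum] at this
    rw [div_le_iff₀ hn']
    simpa [mul_comm] using this
  set y' : Fin n → Fin m → ℝ := fun i => Function.update (y i) c₀ (q i) with hy'
  have hself : ∀ i, y' i c₀ = q i := fun i => by simp [hy']
  have hother : ∀ i c, c ≠ c₀ → y' i c = y i c := fun i c hcc => by simp [hy', hcc]
  have hrem : ∀ i, remainingBudget k y' i = b i - q i := by
    intro i
    have h1 : ∑ c, y' i c = q i + ∑ c ∈ univ \ {c₀}, y i c :=
      Finset.sum_update_of_mem (mem_univ c₀) (y i) (q i)
    have h2 : ∑ c, y i c = ∑ c ∈ univ \ {c₀}, y i c := by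
      rw [← Finset.sum_sdiff (subset_univ {c₀})]
      simp [h.eq_zero_of_notMem i c₀ hc₀]
    simp only [hb, remainingBudget, h1, h2]
    ring
  refine ⟨c₀, hc₀, y', ?_, ?_, ?_, ?_, ?_, ?_, ?_⟩
  · intro i c
    by_cases hcc : c = c₀
    · rw [hcc, hself]; exact hq0 i
    · rw [hother i c hcc]; exact h.nonneg i c
  · intro i c hcW
    rw [mem_insert, not_or] at hcW
    rw [hother i c hcW.1]
    exact h.eq_zero_of_notMem i c hcW.2
  · intro i c hcA
    by_cases hcc : c = c₀
    · subst hcc; rw [hself]; simp [hq, hcA]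
    · rw [hother i c hcc]; exact h.eq_zero_of_not_approved i c hcA
  · intro c hcW
    by_cases hcc : c = c₀
    · subst hcc; simpa only [hself] using hqsum
    · simp only [hother _ c hcc]
      exact h.sum_eq_one c ((mem_insert.1 hcW).resolve_left hcc)
  · intro i
    rw [hrem]
    exact sub_nonneg.2 (hqb i)
  · intro i c hcAW
    rw [mem_inter, mem_insert] at hcAW
    rw [hrem]
    by_cases hcc : c = c₀
    · subst hcc
      rw [hself]
      simp only [hq, if_pos hcAW.1]
      rcases min_choice (b i) r with h1 | h1 <;> rw [h1]
      · right; ring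
      · exact Or.inl hrn
    · rw [hother i c hcc]
      rcases h.fair i c (mem_inter.2 ⟨hcAW.1, hcAW.2.resolve_left hcc⟩) with h1 | h1
      · exact Or.inl h1
      · right
        have h1 : b i = 0 := h1
        linarith [hq0 i, hqb i]
  · intro c N' l hcW hl hN hcA hW i hi c'
    rw [mem_insert, not_or] at hcW
    have hW' : ∀ i ∈ N', (A i ∩ W).card < l := fun i hi =>
      (card_le_card (inter_subset_inter_left (subset_insert _ _))).trans_lt (hW i hi)
    by_cases hcc : c' = c₀
    · rw [hcc, hself]
      refine (hqr i).trans (hleast c hcW.2 _ (by positivity) ?_)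
      refine (one_le_sum_of_large hk hn hl hN fun j hj => ?_).trans
        (Finset.sum_le_sum_of_subset_of_nonneg (s := N') (fun j hj => by simpa using hcA j hj)
          fun j _ _ => le_min (h.remaining_nonneg j) (by positivity))
      exact le_min (h.le_remainingBudget hcW.2 hl hN hcA hW' hj) le_rfl
    · rw [hother i c' hcc]
      exact h.payment_le c N' l hcW.2 hl hN hcA hW' i hi c'

/-- The Method of Equal Shares terminates. -/
lemma exists_isEqualSharesState_final {k : ℕ} (hn : 0 < n) (hk : 0 < k)
    (A : Fin n → Finset (Fin m)) :
    ∃ W y, IsEqualSharesState k A W y ∧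
      ∀ c ∉ W, ∑ i with c ∈ A i, remainingBudget k y i < 1 := by
  have h0 : IsEqualSharesState k A ∅ fun _ _ => 0 := by
    refine ⟨?_, ?_, ?_, ?_, ?_, ?_, ?_⟩ <;> simp [remainingBudget] <;> intros <;> positivity
  obtain ⟨W, ⟨y, hy⟩, hmax⟩ := (Set.toFinite {W | ∃ y, IsEqualSharesState k A W y}).exists_maximal
    ⟨∅, _, h0⟩
  refine ⟨W, y, hy, ?_⟩
  by_contra! hc
  obtain ⟨c₀, hc₀, y', hy'⟩ := hy.exists_insert hn hk hc
  exact hc₀ (hmax ⟨y', hy'⟩ (subset_insert c₀ W) (mem_insert_self c₀ W))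

lemma IsEqualSharesState.ejrPlus {k : ℕ} (hn : 0 < n) (hk : 0 < k)
    {A : Fin n → Finset (Fin m)} {W : Finset (Fin m)} {y : Fin n → Fin m → ℝ}
    (h : IsEqualSharesState k A W y)
    (hfin : ∀ c ∉ W, ∑ i with c ∈ A i, remainingBudget k y i < 1) : EJRplus k A W := by
  rintro ⟨c, N', l, hc, hl, hN, hA, hW⟩
  refine (hfin c hc).not_ge ((one_le_sum_of_large hk hn hl hN fun i hi =>
    h.le_remainingBudget hc hl hN hA hW hi).trans ?_)
  exact Finset.sum_le_sum_of_subset_of_nonneg (fun j hj => by simpa using hA j hj)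
    fun j _ _ => h.remaining_nonneg j

lemma EJRplus.mono {k : ℕ} {A : Fin n → Finset (Fin m)} {W W' : Finset (Fin m)}
    (h : EJRplus k A W) (hW : W ⊆ W') : EJRplus k A W' := by
  rintro ⟨c, N', l, hc, hl, hN, hA, hlt⟩
  exact h ⟨c, N', l, fun h' => hc (hW h'), hl, hN, hA, fun i hi =>
    (card_le_card (inter_subset_inter_left hW)).trans_lt (hlt i hi)⟩

/-- Fractional committees of size `k` that fully contain `W`. -/
def fractionalCommitteesAbove (k : ℕ) (W : Finset (Fin m)) : Set (Fin m → ℝ) :=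
  {p | IsFractionalCommittee k p ∧ ∀ c ∈ W, p c = 1}

/-- The indicator vectors of the integral committees of size `k` that contain `W`. -/
def integralCommitteesAbove (k : ℕ) (W : Finset (Fin m)) : Set (Fin m → ℝ) :=
  (fun V c => if c ∈ V then 1 else 0) '' {V : Finset (Fin m) | V.card = k ∧ W ⊆ V}

lemma convex_fractionalCommitteesAbove (k : ℕ) (W : Finset (Fin m)) :
    Convex ℝ (fractionalCommitteesAbove k W) := by
  rintro p ⟨⟨hp1, hp2⟩, hp3⟩ q ⟨⟨hq1, hq2⟩, hq3⟩ a b ha hb hab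
  refine ⟨⟨fun c => ⟨?_, ?_⟩, ?_⟩, fun c hc => ?_⟩
  · simp only [Pi.add_apply, Pi.smul_apply, smul_eq_mul]
    nlinarith [mul_nonneg ha (hp1 c).1, mul_nonneg hb (hq1 c).1]
  · simp only [Pi.add_apply, Pi.smul_apply, smul_eq_mul]
    nlinarith [mul_le_mul_of_nonneg_left (hp1 c).2 ha, mul_le_mul_of_nonneg_left (hq1 c).2 hb]
  · simp only [Pi.add_apply, Pi.smul_apply, smul_eq_mul, Finset.sum_add_distrib,
      ← Finset.mul_sum, hp2, hq2]
    rw [← add_mul, hab, one_mul]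
  · simp [hp3 c hc, hq3 c hc, hab]

lemma isCompact_fractionalCommitteesAbove (k : ℕ) (W : Finset (Fin m)) :
    IsCompact (fractionalCommitteesAbove k W) := by
  have heq : fractionalCommitteesAbove k W = Set.Icc (0 : Fin m → ℝ) 1 ∩
      ({p | ∑ c, p c = (k : ℝ)} ∩ ⋂ c ∈ W, {p | p c = 1}) := by
    ext p
    simp [fractionalCommitteesAbove, IsFractionalCommittee, Pi.le_def, forall_and, and_assoc]
  rw [heq]
  refine isCompact_Icc.inter_right ((isClosed_eq (by fun_prop) continuous_const).inter ?_)
  exact isClosed_biInter fun c _ => isClosed_eq (by fun_prop) continuous_const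

/-- If a point of `[0, 1]^m` with integral coordinate sum has a fractional coordinate, it has
another one. -/
lemma exists_second_fractional {k : ℕ} {p : Fin m → ℝ} (hp : ∑ c, p c = (k : ℝ)) {a : Fin m}
    (ha : 0 < p a ∧ p a < 1) : ∃ b ≠ a, p b ≠ 0 ∧ p b ≠ 1 := by
  by_contra! hb
  have h1 : ∑ c ∈ univ.erase a, p c = (((univ.erase a).filter fun c => p c = 1).card : ℝ) := by
    rw [Finset.card_filter, Nat.cast_sum]
    refine Finset.sum_congr rfl fun c hc => ?_
    by_cases h0 : p c = 0
    · simp [h0]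
    · simp [hb c (ne_of_mem_erase hc) h0]
  rw [← Finset.add_sum_erase _ _ (mem_univ a), h1] at hp
  have h2 : ((univ.erase a).filter fun c => p c = 1).card < k := by
    exact_mod_cast (by linarith [ha.1] :
      (((univ.erase a).filter fun c => p c = 1).card : ℝ) < k)
  have h3 : (((univ.erase a).filter fun c => p c = 1).card : ℝ) + 1 ≤ k := by exact_mod_cast h2
  linarith [ha.2]

lemma extremePoints_fractionalCommitteesAbove_subset (k : ℕ) (W : Finset (Fin m)) :
    (fractionalCommitteesAbove k W).extremePoints ℝ ⊆ integralCommitteesAbove k W := by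
  rintro p ⟨⟨⟨hp1, hp2⟩, hp3⟩, hext⟩
  have hint : ∀ c, p c = 0 ∨ p c = 1 := by
    by_contra! hfrac
    obtain ⟨a, ha0, ha1⟩ := hfrac
    have ha : 0 < p a ∧ p a < 1 := ⟨(hp1 a).1.lt_of_ne' ha0, (hp1 a).2.lt_of_ne ha1⟩
    obtain ⟨b, hba, hb0, hb1⟩ := exists_second_fractional hp2 ha
    have hb : 0 < p b ∧ p b < 1 := ⟨(hp1 b).1.lt_of_ne' hb0, (hp1 b).2.lt_of_ne hb1⟩
    obtain ⟨e, he0, he⟩ : ∃ e : ℝ, 0 < e ∧ e ≤ p a ∧ e ≤ 1 - p a ∧ e ≤ p b ∧ e ≤ 1 - p b :=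
      ⟨min (min (p a) (1 - p a)) (min (p b) (1 - p b)),
        lt_min (lt_min ha.1 (by linarith)) (lt_min hb.1 (by linarith)), by simp⟩
    have hmem : ∀ t : ℝ, |t| ≤ e →
        p + t • (Pi.single a 1 - Pi.single b 1) ∈ fractionalCommitteesAbove k W := by
      intro t ht
      rw [abs_le] at ht
      refine ⟨⟨fun c => ?_, ?_⟩, fun c hc => ?_⟩
      · simp only [Pi.add_apply, Pi.smul_apply, Pi.sub_apply, smul_eq_mul]
        by_cases hca : c = a
        · subst hca
          rw [Pi.single_eq_same, Pi.single_eq_of_ne hba.symm]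
          constructor <;> linarith
        · by_cases hcb : c = b
          · subst hcb
            rw [Pi.single_eq_same, Pi.single_eq_of_ne hca]
            constructor <;> linarith
          · simpa [hca, hcb] using hp1 c
      · simp [Finset.sum_add_distrib, ← Finset.mul_sum, hp2]
      · have hca : c ≠ a := fun h' => ha1 (h' ▸ hp3 c hc)
        have hcb : c ≠ b := fun h' => hb1 (h' ▸ hp3 c hc)
        simp [hca, hcb, hp3 c hc]
    have h1 := hext (hmem e (by rw [abs_of_pos he0])) (hmem (-e) (by rw [abs_neg, abs_of_pos he0]))
      ⟨1 / 2, 1 / 2, by norm_num, by norm_num, by norm_num, by ext c; simp; ring⟩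
    have h2 := congrFun h1 a
    simp [hba.symm, he0.ne'] at h2
  refine ⟨univ.filter fun c => p c = 1, ⟨?_, fun c hc => by simpa using hp3 c hc⟩, ?_⟩
  · have : ((univ.filter fun c => p c = 1).card : ℝ) = k := by
      rw [← hp2, Finset.card_filter, Nat.cast_sum]
      refine Finset.sum_congr rfl fun c _ => ?_
      rcases hint c with h | h <;> simp [h]
    exact_mod_cast this
  · ext c
    rcases hint c with h | h <;> simp [h]

lemma fractionalCommitteesAbove_subset_convexHull (k : ℕ) (W : Finset (Fin m)) :
    fractionalCommitteesAbove k W ⊆ convexHull ℝ (integralCommitteesAbove k W) := by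
  refine (closure_convexHull_extremePoints (isCompact_fractionalCommitteesAbove k W)
    (convex_fractionalCommitteesAbove k W)).ge.trans ?_
  exact closure_minimal (convexHull_mono (extremePoints_fractionalCommitteesAbove_subset k W))
    (((Set.toFinite _).image _).isClosed_convexHull ℝ)

/-- A fractional committee is implemented by integral committees that contain every candidate
of `W`, provided all of these have probability one. -/
lemma exists_implements {k : ℕ} {W : Finset (Fin m)} {p : Fin m → ℝ}
    (hp : IsFractionalCommittee k p) (hW : ∀ c ∈ W, p c = 1) :
    ∃ (s : ℕ) (lam : Fin s → ℝ) (V : Fin s → Finset (Fin m)), (∀ j, 0 ≤ lam j) ∧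
      ∑ j, lam j = 1 ∧ (∀ j, (V j).card = k ∧ W ⊆ V j) ∧ Implements lam V p := by
  obtain ⟨ι, _, w, z, hw0, hw1, hz, hsum⟩ :=
    mem_convexHull_iff_exists_fintype.1 (fractionalCommitteesAbove_subset_convexHull k W ⟨hp, hW⟩)
  choose V hV hVz using hz
  let e := (Fintype.equivFin ι).symm
  refine ⟨Fintype.card ι, w ∘ e, V ∘ e, fun j => hw0 _, ?_, fun j => hV _, fun c => ?_⟩
  · rw [← hw1]; exact e.sum_comp w
  · rw [← hsum, Finset.sum_apply, ← e.sum_comp]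
    exact Finset.sum_congr rfl fun j _ => by simp [← hVz]

/-- Each voter can spend its remaining budget on an approved candidate outside `W`, if any. -/
lemma exists_spending (A W : Finset (Fin m)) {b : ℝ} (hb : 0 ≤ b) :
    ∃ z : Fin m → ℝ, (∀ c, 0 ≤ z c) ∧ (∀ c, z c ≤ b) ∧ (∀ c, c ∉ A → z c = 0) ∧
      (∀ c ∈ W, z c = 0) ∧ ∑ c, z c ≤ b ∧ (¬ A ⊆ W → ∑ c, z c = b) := by
  by_cases h : A ⊆ W
  · exact ⟨0, by simp [h, hb]⟩
  · obtain ⟨a, haA, haW⟩ := not_subset.1 h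
    refine ⟨Pi.single a b, fun c => ?_, fun c => ?_, fun c hc => ?_, fun c hc => ?_, by simp,
      by simp⟩
    · rw [Pi.single_apply]; split_ifs <;> simp [hb]
    · rw [Pi.single_apply]; split_ifs <;> simp [hb]
    · exact Pi.single_eq_of_ne (ne_of_mem_of_not_mem haA hc |>.symm) _
    · exact Pi.single_eq_of_ne (ne_of_mem_of_not_mem hc haW) _

/-- A vector in `[0, 1]^m` of weight at most `k ≤ m` extends to a fractional committee. -/
lemma exists_fractionalCommittee_ge {k : ℕ} (hkm : k ≤ m) {q : Fin m → ℝ}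
    (hq : ∀ c, 0 ≤ q c ∧ q c ≤ 1) (hsum : ∑ c, q c ≤ (k : ℝ)) :
    ∃ p, IsFractionalCommittee k p ∧ ∀ c, q c ≤ p c := by
  have hkm' : (k : ℝ) ≤ m := by exact_mod_cast hkm
  rcases hsum.eq_or_lt with heq | hlt
  · exact ⟨q, ⟨hq, heq⟩, fun c => le_rfl⟩
  have hden : 0 < m - ∑ c, q c := by linarith
  set t := (k - ∑ c, q c) / (m - ∑ c, q c) with ht
  have ht0 : 0 ≤ t := div_nonneg (by linarith) hden.le
  have ht1 : t ≤ 1 := (div_le_one hden).2 (by linarith)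
  refine ⟨fun c => q c + t * (1 - q c), ⟨fun c => ⟨?_, ?_⟩, ?_⟩, fun c => ?_⟩
  · have := hq c
    nlinarith [mul_nonneg ht0 (sub_nonneg.2 this.2)]
  · have := hq c
    nlinarith [mul_le_mul_of_nonneg_right ht1 (sub_nonneg.2 this.2)]
  · have h1 : t * (m - ∑ c, q c) = k - ∑ c, q c := div_mul_cancel₀ _ hden.ne'
    simp only [Finset.sum_add_distrib, ← Finset.mul_sum, Finset.sum_sub_distrib]
    simp only [sum_const, card_univ, Fintype.card_fin, nsmul_eq_mul, mul_one]
    linarith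
  · have := mul_nonneg ht0 (sub_nonneg.2 (hq c).2)
    simp only
    linarith

/-- If every voter of `S` spends at least `f i` on approved candidates, then the candidates
approved by `S` receive at least the total. -/
lemma sum_le_sum_biUnion {A : Fin n → Finset (Fin m)} {x : Fin n → Fin m → ℝ} {p : Fin m → ℝ}
    (hx : ∀ i c, 0 ≤ x i c) (hp : ∀ c, ∑ i, x i c ≤ p c) {f : Fin n → ℝ} (S : Finset (Fin n))
    (hf : ∀ i ∈ S, f i ≤ ∑ c ∈ A i, x i c) : ∑ i ∈ S, f i ≤ ∑ c ∈ S.biUnion A, p c :=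
  calc ∑ i ∈ S, f i ≤ ∑ i ∈ S, ∑ c ∈ S.biUnion A, x i c :=
        Finset.sum_le_sum fun i hi => (hf i hi).trans <|
          Finset.sum_le_sum_of_subset_of_nonneg (subset_biUnion_of_mem A hi) fun c _ _ => hx i c
    _ = ∑ c ∈ S.biUnion A, ∑ i ∈ S, x i c := Finset.sum_comm
    _ ≤ ∑ c ∈ S.biUnion A, p c := Finset.sum_le_sum fun c _ =>
        (Finset.sum_le_sum_of_subset_of_nonneg (subset_univ S) fun i _ _ => hx i c).trans (hp c)

theorem bw_mes_plus_exists (n m k : ℕ) (hn : 0 < n) (hk : 0 < k) (hkm : k ≤ m)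
    (A : Fin n → Finset (Fin m)) (hA : ∀ i, (A i).Nonempty) :
    ∃ (s : ℕ), 0 < s ∧ ∃ (lam : Fin s → ℝ) (W : Fin s → Finset (Fin m)) (p : Fin m → ℝ),
      (∀ j, 0 ≤ lam j) ∧ (∑ j, lam j = 1) ∧ (∀ j, (W j).card = k) ∧
      Implements lam W p ∧
      (∀ j, EJRplus k A (W j)) ∧ GFS k A p ∧ StrongUFS k A p := by
  have hn' : (0 : ℝ) < n := by exact_mod_cast hn
  obtain ⟨W, y, hy, hfin⟩ := exists_isEqualSharesState_final hn hk A
  choose z hz0 hzb hzA hzW hzle hzeq using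
    fun i => exists_spending (A i) W (hy.remaining_nonneg i)
  set x : Fin n → Fin m → ℝ := fun i c => y i c + z i c with hx
  have hx0 : ∀ i c, 0 ≤ x i c := fun i c => add_nonneg (hy.nonneg i c) (hz0 i c)
  have hxsum : ∀ i, ∑ c, x i c = ∑ c ∈ A i, x i c := fun i =>
    (Finset.sum_subset (subset_univ _) fun c _ hc => by
      simp [hx, hy.eq_zero_of_not_approved i c hc, hzA i c hc]).symm
  have hxtotal : ∀ i, ∑ c, x i c = (k : ℝ) / n - remainingBudget k y i + ∑ c, z i c := fun i => by
    simp only [hx, Finset.sum_add_distrib, remainingBudget]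
    ring
  have hxW : ∀ c ∈ W, ∑ i, x i c = 1 := fun c hc => by
    simp [hx, hzW _ c hc, hy.sum_eq_one c hc]
  have hxle : ∀ c, ∑ i, x i c ≤ 1 := fun c => by
    by_cases hc : c ∈ W
    · exact (hxW c hc).le
    · refine le_trans ?_ (hfin c hc).le
      rw [Finset.sum_filter]
      refine Finset.sum_le_sum fun i _ => ?_
      simp only [hx, hy.eq_zero_of_notMem i c hc, zero_add]
      split_ifs with hcA
      · exact hzb i c
      · exact (hzA i c hcA).le
  have hxk : ∑ c, ∑ i, x i c ≤ (k : ℝ) := by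
    rw [Finset.sum_comm]
    calc ∑ i, ∑ c, x i c ≤ ∑ _i : Fin n, (k : ℝ) / n :=
          Finset.sum_le_sum fun i _ => by rw [hxtotal]; linarith [hzle i]
      _ = k := by simp; field_simp
  have hfull : ∀ i, ¬ A i ⊆ W → ∑ c ∈ A i, x i c = (k : ℝ) / n := fun i hi => by
    rw [← hxsum, hxtotal, hzeq i hi]; ring
  have hshare : ∀ i, 1 / (n : ℝ) * ((min k (A i).card : ℕ) : ℝ) ≤ ∑ c ∈ A i, x i c := by
    intro i
    have hmink : 1 / (n : ℝ) * ((min k (A i).card : ℕ) : ℝ) ≤ (k : ℝ) / n := by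
      rw [one_div_mul_eq_div]; gcongr; exact min_le_left _ _
    by_cases hi : A i ⊆ W
    · by_cases hb : remainingBudget k y i = 0
      · rw [← hxsum, hxtotal, hb, sub_zero]
        exact hmink.trans (le_add_of_nonneg_right (Finset.sum_nonneg fun c _ => hz0 i c))
      · have h1 : (A i).card • (1 / (n : ℝ)) ≤ ∑ c ∈ A i, x i c :=
          Finset.card_nsmul_le_sum _ _ _ fun c hc =>
            ((hy.fair i c (mem_inter.2 ⟨hc, hi hc⟩)).resolve_right hb).trans
              (le_add_of_nonneg_right (hz0 i c))
        refine le_trans ?_ h1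
        rw [nsmul_eq_mul, mul_comm]
        gcongr
        exact min_le_right _ _
    · rw [hfull i hi]; exact hmink
  obtain ⟨p, hp, hpx⟩ := exists_fractionalCommittee_ge hkm
    (fun c => ⟨Finset.sum_nonneg fun i _ => hx0 i c, hxle c⟩) hxk
  have hpW : ∀ c ∈ W, p c = 1 := fun c hc =>
    le_antisymm (hp.1 c).2 ((hxW c hc).symm.le.trans (hpx c))
  obtain ⟨s, lam, V, hlam, hsum, hV, himp⟩ := exists_implements hp hpW
  have hs : 0 < s := by
    rcases Nat.eq_zero_or_pos s with rfl | hs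
    · simp at hsum
    · exact hs
  refine ⟨s, hs, lam, V, p, hlam, hsum, fun j => (hV j).1, himp,
    fun j => (hy.ejrPlus hn hk hfin).mono (hV j).2, fun S => ?_, fun S hS i hi => ?_⟩
  · rw [Finset.mul_sum]
    exact sum_le_sum_biUnion hx0 hpx S fun i _ => hshare i
  · unfold utility
    by_cases hiW : A i ⊆ W
    · refine (min_le_right _ _).trans (le_of_eq ?_)
      rw [Finset.sum_congr rfl fun c hc => hpW c (hiW hc)]
      simp
    · refine (min_le_left _ _).trans ?_
      have hU : S.biUnion A = A i := by
        ext c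
        simp only [mem_biUnion]
        exact ⟨fun ⟨j, hj, hc⟩ => hS i hi j hj ▸ hc, fun hc => ⟨i, hi, hc⟩⟩
      have h1 := sum_le_sum_biUnion hx0 hpx (f := fun _ => (k : ℝ) / n) S fun j hj =>
        (hfull j (hS i hi j hj ▸ hiW)).ge
      rw [hU, sum_const, nsmul_eq_mul] at h1
      rwa [mul_div_assoc]

end BWCV
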